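/- Let d ≥ 1 be an integer, ℓ > 0 a constant, and A₁, A₂ : ℝ → ℝ differentiable functions with A₁'(Q) = ℓ and A₂'(Q) = −ℓ for all Q. Let (Q, W, E₁, E₂) : J → ℝ⁴ be differentiable on an interval J containing 0 and solve the averaged equation Q' = W, W' = (2ℓ/d)(E₁/A₁(Q) − E₂/A₂(Q)), E₁' = −(2ℓ/d)·W·E₁/A₁(Q), E₂' = (2ℓ/d)·W·E₂/A₂(Q), with A₁(Q(τ)) > 0 and A₂(Q(τ)) > 0 for all τ ∈ J. Then Q is twice differentiable on J and satisfies the effective Newton equation Q''(τ) = (2ℓ/d)·[E₁(0)·A₁(Q(0))^{2/d}·A₁(Q(τ))^{−(1+2/d)} − E₂(0)·A₂(Q(0))^{2/d}·A₂(Q(τ))^{−(1+2/d)}] for all τ ∈ J. -/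

import Mathlib

/-- The adiabatic invariant: if `E' = -p (a' / a) E` with `a > 0` on a convex set, then `E a ^ p` is
constant there. -/
theorem mul_rpow_eq_of_hasDerivAt {J : Set ℝ} (hJ : Convex ℝ J) {a a' E : ℝ → ℝ} {p : ℝ}
    (ha : ∀ t ∈ J, HasDerivAt a (a' t) t) (hpos : ∀ t ∈ J, 0 < a t)
    (hE : ∀ t ∈ J, HasDerivAt E (-p * a' t * E t / a t) t) {s t : ℝ} (hs : s ∈ J) (ht : t ∈ J) :
    E t * a t ^ p = E s * a s ^ p := by
  have hderiv : ∀ x ∈ J, HasDerivWithinAt (fun y => E y * a y ^ p) 0 J x := by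
    intro x hx
    have hx0 := (hpos x hx).ne'
    refine HasDerivAt.hasDerivWithinAt ?_
    refine ((hE x hx).mul ((ha x hx).rpow_const (p := p) (Or.inl hx0))).congr_deriv ?_
    rw [Real.rpow_sub_one hx0]
    field_simp
    ring
  have h := hJ.norm_image_sub_le_of_norm_hasDerivWithin_le (C := 0) hderiv (by simp) hs ht
  rw [zero_mul, norm_le_zero_iff, sub_eq_zero] at h
  exact h

/-- Under the same equation, `E / a` is the initial value of `E a ^ p` times `a ^ (-(1 + p))`. -/
theorem div_eq_mul_rpow_of_hasDerivAt {J : Set ℝ} (hJ : Convex ℝ J) {a a' E : ℝ → ℝ} {p : ℝ}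
    (ha : ∀ t ∈ J, HasDerivAt a (a' t) t) (hpos : ∀ t ∈ J, 0 < a t)
    (hE : ∀ t ∈ J, HasDerivAt E (-p * a' t * E t / a t) t) {s t : ℝ} (hs : s ∈ J) (ht : t ∈ J) :
    E t / a t = E s * a s ^ p * a t ^ (-(1 + p)) := by
  have h0 := hpos t ht
  have hp := (Real.rpow_pos_of_pos h0 p).ne'
  rw [← mul_rpow_eq_of_hasDerivAt hJ ha hpos hE hs ht, Real.rpow_neg h0.le, Real.rpow_add h0,
    Real.rpow_one]
  field_simp

/-- The effective Newton equation: along solutions of the averaged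
(Neishtadt–Sinai) piston equation, `Q'' = W'` equals
`(2ℓ/d)[E₁(0)A₁(Q(0))^{2/d}A₁(Q)^{-(1+2/d)} − E₂(0)A₂(Q(0))^{2/d}A₂(Q)^{-(1+2/d)}]`. -/
theorem averaged_equation_effective_newton
    (d : ℕ) (hd : 1 ≤ d) (ℓ : ℝ) (hℓ : 0 < ℓ)
    (A₁ A₂ : ℝ → ℝ)
    (hA₁ : ∀ Q : ℝ, HasDerivAt A₁ ℓ Q) (hA₂ : ∀ Q : ℝ, HasDerivAt A₂ (-ℓ) Q)
    (J : Set ℝ) (hJ : Convex ℝ J) (h0J : (0 : ℝ) ∈ J)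
    (Q W E₁ E₂ : ℝ → ℝ)
    (hQ : ∀ τ ∈ J, HasDerivAt Q (W τ) τ)
    (hW : ∀ τ ∈ J, HasDerivAt W
      ((2 * ℓ / d) * (E₁ τ / A₁ (Q τ) - E₂ τ / A₂ (Q τ))) τ)
    (hE₁ : ∀ τ ∈ J, HasDerivAt E₁ (-(2 * ℓ / d) * W τ * E₁ τ / A₁ (Q τ)) τ)
    (hE₂ : ∀ τ ∈ J, HasDerivAt E₂ ((2 * ℓ / d) * W τ * E₂ τ / A₂ (Q τ)) τ)
    (hA₁pos : ∀ τ ∈ J, 0 < A₁ (Q τ)) (hA₂pos : ∀ τ ∈ J, 0 < A₂ (Q τ)) :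
    ∀ τ ∈ J, HasDerivAt W
      ((2 * ℓ / d) *
        (E₁ 0 * (A₁ (Q 0)) ^ ((2 : ℝ) / d) * (A₁ (Q τ)) ^ (-(1 + (2 : ℝ) / d))
          - E₂ 0 * (A₂ (Q 0)) ^ ((2 : ℝ) / d) * (A₂ (Q τ)) ^ (-(1 + (2 : ℝ) / d)))) τ := by
  intro τ hτ
  have h₁ := div_eq_mul_rpow_of_hasDerivAt (a := fun t => A₁ (Q t)) (p := 2 / d) hJ
    (fun t ht => (hA₁ (Q t)).comp t (hQ t ht)) hA₁pos
    (fun t ht => by convert hE₁ t ht using 1; ring) h0J hτ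
  have h₂ := div_eq_mul_rpow_of_hasDerivAt (a := fun t => A₂ (Q t)) (p := 2 / d) hJ
    (fun t ht => (hA₂ (Q t)).comp t (hQ t ht)) hA₂pos
    (fun t ht => by convert hE₂ t ht using 1; ring) h0J hτ
  rw [← h₁, ← h₂]
  exact hW τ hτ
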